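/- Let a and b be positive integers and let D : Matrix (Fin a) (Fin b) ℝ have nonnegative entries, with every row of D nonzero and every entry of Dᵀ * D strictly positive. Let d > 0 and α : Fin a → ℝ, β : Fin b → ℝ have strictly positive entries with D.mulVec β = d • α and Dᵀ.mulVec α = d • β. Let η : Fin a → ℝ and ξ : Fin b → ℝ have strictly positive entries and suppose ξ j = ∑ i, η i * D i j for all j. Then (∀ i, ∑ j, (ξ j / η i) * D i j = d ^ 2) holds if and only if (∀ i j, ξ j / η i = d * β j / α i). -/

import Mathlib

open Matrix

/-- An eigenvector of an entrywise positive matrix is a multiple of any positive eigenvector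
with the same eigenvalue. -/
theorem Matrix.eq_smul_of_mulVec_eq_smul_of_pos {n : Type*} [Fintype n] [Nonempty n]
    {M : Matrix n n ℝ} (hM : ∀ i j, 0 < M i j) {r : ℝ} {x y : n → ℝ} (hy : ∀ i, 0 < y i)
    (hMx : M *ᵥ x = r • x) (hMy : M *ᵥ y = r • y) : ∃ c : ℝ, x = c • y := by
  obtain ⟨k, hk⟩ := Finite.exists_min fun i => x i / y i
  refine ⟨x k / y k, ?_⟩
  set c := x k / y k
  have hv : ∀ i, 0 ≤ (x - c • y) i := fun i => by
    have := (le_div_iff₀ (hy i)).1 (hk i)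
    simpa using this
  have hvk : (x - c • y) k = 0 := by
    simp [c, (hy k).ne']
  have hMv : M *ᵥ (x - c • y) = r • (x - c • y) := by
    rw [mulVec_sub, mulVec_smul, hMx, hMy, smul_sub, smul_comm]
  have hsum : ∑ i, M k i * (x - c • y) i = 0 := by
    have := congrFun hMv k
    rwa [Pi.smul_apply, hvk, smul_zero] at this
  rw [Finset.sum_eq_zero_iff_of_nonneg fun i _ => mul_nonneg (hM k i).le (hv i)] at hsum
  refine sub_eq_zero.1 (funext fun i => ?_)
  exact (mul_eq_zero.1 (hsum i (Finset.mem_univ i))).resolve_left (hM k i).ne'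

/-- Theorem 4.9 (H2) ⇔ (H4): for a distortion matrix `δ i j = ξ j / η i`
normalized by `ξ = ηD`, homogeneity `∑ j, δ i j * D i j = d²` for all `i` is
equivalent to `δ` being the standard distortion `d * β j / α i`. -/
theorem stmt_10 (a b : ℕ) (ha : 0 < a) (hb : 0 < b)
    (D : Matrix (Fin a) (Fin b) ℝ)
    (hD : ∀ i j, 0 ≤ D i j)
    (hrow : ∀ i, D i ≠ 0)
    (hDTD : ∀ j j', 0 < (Dᵀ * D) j j')
    (d : ℝ) (hd : 0 < d)
    (α : Fin a → ℝ) (β : Fin b → ℝ)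
    (hα : ∀ i, 0 < α i) (hβ : ∀ j, 0 < β j)
    (h1 : D.mulVec β = d • α) (h2 : Dᵀ.mulVec α = d • β)
    (η : Fin a → ℝ) (ξ : Fin b → ℝ)
    (hη : ∀ i, 0 < η i) (hξ : ∀ j, 0 < ξ j)
    (hnorm : ∀ j, ξ j = ∑ i, η i * D i j) :
    (∀ i, ∑ j, (ξ j / η i) * D i j = d ^ 2) ↔
    (∀ i j, ξ j / η i = d * β j / α i) := by
  constructor
  · intro h i j
    have : Nonempty (Fin b) := ⟨⟨0, hb⟩⟩
    have hDξ : D *ᵥ ξ = d ^ 2 • η := by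
      ext i
      calc ∑ j, D i j * ξ j = η i * ∑ j, (ξ j / η i) * D i j := by
            rw [Finset.mul_sum]
            refine Finset.sum_congr rfl fun j _ => ?_
            have := (hη i).ne'
            field_simp
        _ = d ^ 2 * η i := by rw [h i, mul_comm]
    have hDη : Dᵀ *ᵥ η = ξ := by
      ext j
      rw [hnorm j]
      change ∑ i, D i j * η i = _
      exact Finset.sum_congr rfl fun i _ => mul_comm (D i j) (η i)
    have hMξ : (Dᵀ * D) *ᵥ ξ = d ^ 2 • ξ := by
      rw [← mulVec_mulVec, hDξ, mulVec_smul, hDη]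
    have hMβ : (Dᵀ * D) *ᵥ β = d ^ 2 • β := by
      rw [← mulVec_mulVec, h1, mulVec_smul, h2, smul_smul, sq]
    obtain ⟨c, rfl⟩ := eq_smul_of_mulVec_eq_smul_of_pos hDTD hβ hMξ hMβ
    have hcα : c * α i = d * η i := by
      rw [mulVec_smul, h1] at hDξ
      have hi : c * (d * α i) = d ^ 2 * η i := congrFun hDξ i
      exact mul_left_cancel₀ hd.ne' (by linear_combination hi)
    rw [div_eq_div_iff (hη i).ne' (hα i).ne', Pi.smul_apply, smul_eq_mul]
    linear_combination β j * hcα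
  · intro h i
    have hDβ : ∑ j, D i j * β j = d * α i := congrFun h1 i
    calc ∑ j, (ξ j / η i) * D i j = d / α i * ∑ j, D i j * β j := by
          rw [Finset.mul_sum]
          refine Finset.sum_congr rfl fun j _ => ?_
          rw [h i j]
          ring
      _ = d ^ 2 := by
          rw [hDβ]
          have := (hα i).ne'
          field_simp
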